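/- Let β ∈ (−1,0) and f ∈ C¹_β[0,1]. Then for every ε ∈ (0,1] and every k > 0, |∫_0^ε f(x) exp(ikx) dx| ≤ (1/(1−|β|)) ((2+|β|)/|β|) (1/k)^{1+β} ‖f‖_{1,β}. -/

import Mathlib

open scoped Real

/-- For `β ∈ (−1,0)`: the set of values `|x^{j−β} v^{(j)}(x)|` for `j = 0,…,m`,
`x ∈ (0,1]`, whose supremum is `‖v‖_{m,β}`. -/
noncomputable def snormSetNeg (m : ℕ) (β : ℝ) (f : ℝ → ℂ) : Set ℝ :=
  {y | ∃ j ≤ m, ∃ x ∈ Set.Ioc (0 : ℝ) 1,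
    y = x ^ ((j : ℝ) - β) * ‖iteratedDerivWithin j f (Set.Ioc (0 : ℝ) 1) x‖}

/-- The norm `‖v‖_{m,β}` for `β ∈ (−1,0)`. -/
noncomputable def snormNeg (m : ℕ) (β : ℝ) (f : ℝ → ℂ) : ℝ := sSup (snormSetNeg m β f)

lemma norm_exp_I_mul_ofReal_mul (k x : ℝ) : ‖Complex.exp (Complex.I * k * x)‖ = 1 := by
  rw [mul_assoc, ← Complex.ofReal_mul, Complex.norm_exp_I_mul_ofReal]

/-- The contribution near the singularity, estimated by absolute values. -/
lemma norm_integral_mul_exp_le_of_norm_le_rpow {β M δ : ℝ} (hβ : -1 < β) (hδ : 0 ≤ δ)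
    {f : ℝ → ℂ} (hf : ∀ x ∈ Set.Ioc 0 δ, ‖f x‖ ≤ M * x ^ β) (k : ℝ) :
    ‖∫ x in (0 : ℝ)..δ, f x * Complex.exp (Complex.I * k * x)‖ ≤
      M * (δ ^ (1 + β) / (1 + β)) := by
  have hle := intervalIntegral.norm_integral_le_of_norm_le (μ := MeasureTheory.volume)
    (f := fun x : ℝ ↦ f x * Complex.exp (Complex.I * k * x)) hδ
    (Filter.Eventually.of_forall fun x hx ↦ by
      rw [norm_mul, norm_exp_I_mul_ofReal_mul, mul_one]
      exact hf x hx)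
    ((intervalIntegral.intervalIntegrable_rpow' hβ).const_mul M)
  rwa [intervalIntegral.integral_const_mul, integral_rpow (Or.inl hβ),
    Real.zero_rpow (by linarith), sub_zero, add_comm β 1] at hle

/-- The contribution away from the singularity, estimated through integration by parts. -/
lemma norm_integral_mul_exp_le_of_hasDerivAt {β M δ ε k : ℝ} (hβ : β ∈ Set.Ioo (-1 : ℝ) 0)
    (hM : 0 ≤ M) (hδ : 0 < δ) (hδε : δ ≤ ε) (hk : 0 < k) {f f' : ℝ → ℂ}
    (hf : ContinuousOn f (Set.Icc δ ε)) (hf' : ContinuousOn f' (Set.Icc δ ε))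
    (hderiv : ∀ x ∈ Set.Ioo δ ε, HasDerivAt f (f' x) x)
    (hfle : ∀ x ∈ Set.Icc δ ε, ‖f x‖ ≤ M * x ^ β)
    (hf'le : ∀ x ∈ Set.Icc δ ε, ‖f' x‖ ≤ M * x ^ (β - 1)) :
    ‖∫ x in δ..ε, f x * Complex.exp (Complex.I * k * x)‖ ≤
      M / k * (δ ^ β * (1 + 1 / (-β))) := by
  have hβ0 : β < 0 := hβ.2
  have hIk : Complex.I * (k : ℂ) ≠ 0 :=
    mul_ne_zero Complex.I_ne_zero (Complex.ofReal_ne_zero.2 hk.ne')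
  set E : ℝ → ℂ := fun x ↦ Complex.exp (Complex.I * k * x) / (Complex.I * k) with hE
  have hEnorm (x : ℝ) : ‖E x‖ = 1 / k := by
    simp [hE, norm_exp_I_mul_ofReal_mul, abs_of_pos hk]
  have hEderiv (x : ℝ) : HasDerivAt E (Complex.exp (Complex.I * k * x)) x := by
    have h := (((hasDerivAt_id (x : ℂ)).const_mul (Complex.I * k)).cexp.div_const
      (Complex.I * k)).comp_ofReal
    simpa [hE, hIk] using h
  have hEcont : Continuous E := continuous_iff_continuousAt.2 fun x ↦ (hEderiv x).continuousAt
  rw [← Set.uIcc_of_le hδε] at hf hf'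
  have hparts := intervalIntegral.integral_mul_deriv_eq_deriv_mul_of_hasDerivAt
    (v' := fun x : ℝ ↦ Complex.exp (Complex.I * k * x)) hf hEcont.continuousOn
    (by rwa [min_eq_left hδε, max_eq_right hδε]) (fun x _ ↦ hEderiv x)
    hf'.intervalIntegrable (Continuous.intervalIntegrable (by fun_prop) _ _)
  have h0 : (0 : ℝ) ∉ Set.uIcc δ ε := by
    rw [Set.uIcc_of_le hδε]
    exact fun h ↦ hδ.not_ge h.1
  have hint : ‖∫ x in δ..ε, f' x * E x‖ ≤ M / k * ((ε ^ β - δ ^ β) / β) := by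
    have hle := intervalIntegral.norm_integral_le_of_norm_le (μ := MeasureTheory.volume)
      (f := fun x : ℝ ↦ f' x * E x) (g := fun x ↦ M / k * x ^ (β - 1)) hδε
      (Filter.Eventually.of_forall fun x hx ↦ by
        rw [norm_mul, hEnorm]
        calc ‖f' x‖ * (1 / k) ≤ M * x ^ (β - 1) * (1 / k) := by
              gcongr
              exact hf'le x (Set.Ioc_subset_Icc_self hx)
          _ = M / k * x ^ (β - 1) := by ring)
      ((intervalIntegral.intervalIntegrable_rpow (Or.inr h0)).const_mul _)
    rwa [intervalIntegral.integral_const_mul,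
      integral_rpow (Or.inr ⟨by linarith, h0⟩), sub_add_cancel] at hle
  have hboundary (x : ℝ) (hx : x ∈ Set.Icc δ ε) : ‖f x * E x‖ ≤ M / k * x ^ β := by
    rw [norm_mul, hEnorm]
    calc ‖f x‖ * (1 / k) ≤ M * x ^ β * (1 / k) := by gcongr; exact hfle x hx
      _ = M / k * x ^ β := by ring
  have hεpow : 0 ≤ ε ^ β := Real.rpow_nonneg (hδ.le.trans hδε) β
  have hinv : 1 ≤ 1 / (-β) := by
    rw [le_div_iff₀ (by linarith)]
    linarith [hβ.1]
  calc ‖∫ x in δ..ε, f x * Complex.exp (Complex.I * k * x)‖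
      = ‖f ε * E ε - f δ * E δ - ∫ x in δ..ε, f' x * E x‖ := by rw [hparts]
    _ ≤ M / k * ε ^ β + M / k * δ ^ β + M / k * ((ε ^ β - δ ^ β) / β) :=
        (norm_sub_le _ _).trans <| add_le_add ((norm_sub_le _ _).trans <|
          add_le_add (hboundary ε ⟨hδε, le_rfl⟩) (hboundary δ ⟨le_rfl, hδε⟩)) hint
    _ = M / k * (δ ^ β * (1 + 1 / (-β)) - ε ^ β * (1 / (-β) - 1)) := by
        field_simp
        ring
    _ ≤ M / k * (δ ^ β * (1 + 1 / (-β))) := by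
        gcongr
        exact sub_le_self _ (mul_nonneg hεpow (by linarith))

lemma norm_iteratedDerivWithin_le_snormNeg_mul_rpow {m j : ℕ} {β x : ℝ} {f : ℝ → ℂ}
    (hbdd : BddAbove (snormSetNeg m β f)) (hj : j ≤ m) (hx : x ∈ Set.Ioc (0 : ℝ) 1) :
    ‖iteratedDerivWithin j f (Set.Ioc (0 : ℝ) 1) x‖ ≤ snormNeg m β f * x ^ (β - j) := by
  have h : x ^ ((j : ℝ) - β) * ‖iteratedDerivWithin j f (Set.Ioc (0 : ℝ) 1) x‖ ≤
      snormNeg m β f := le_csSup hbdd ⟨j, hj, x, hx, rfl⟩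
  rw [← neg_sub (j : ℝ) β, Real.rpow_neg hx.1.le, ← div_eq_mul_inv,
    le_div_iff₀ (Real.rpow_pos_of_pos hx.1 _), mul_comm]
  exact h

lemma snormNeg_nonneg (m : ℕ) (β : ℝ) (f : ℝ → ℂ) : 0 ≤ snormNeg m β f := by
  refine Real.sSup_nonneg ?_
  rintro _ ⟨j, -, x, hx, rfl⟩
  exact mul_nonneg (Real.rpow_nonneg hx.1.le _) (norm_nonneg _)

/-- Let `β ∈ (−1,0)` and `f ∈ C¹_β[0,1]`.  Then for every `ε ∈ (0,1]`
and `k > 0`,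
`|∫_0^ε f(x) exp(ikx) dx| ≤ (1/(1−|β|)) ((2+|β|)/|β|) (1/k)^{1+β} ‖f‖_{1,β}`. -/
theorem singular_integral_k_decay (β : ℝ) (hβ : β ∈ Set.Ioo (-1 : ℝ) 0)
    (f : ℝ → ℂ)
    (hdiff : ContDiffOn ℝ 1 f (Set.Ioc (0 : ℝ) 1))
    (hbdd : BddAbove (snormSetNeg 1 β f)) :
    ∀ ε ∈ Set.Ioc (0 : ℝ) 1, ∀ k : ℝ, 0 < k →
      ‖∫ x in (0 : ℝ)..ε, f x * Complex.exp (Complex.I * k * x)‖ ≤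
        (1 / (1 - |β|)) * ((2 + |β|) / |β|) * (1 / k) ^ (1 + β) *
          snormNeg 1 β f := by
  intro ε hε k hk
  obtain ⟨hβ1, hβ0⟩ := hβ
  set M := snormNeg 1 β f
  have hM : 0 ≤ M := snormNeg_nonneg 1 β f
  have hfle : ∀ x ∈ Set.Ioc (0 : ℝ) 1, ‖f x‖ ≤ M * x ^ β := fun x hx ↦ by
    simpa using norm_iteratedDerivWithin_le_snormNeg_mul_rpow hbdd zero_le_one hx
  have hf'le : ∀ x ∈ Set.Ioc (0 : ℝ) 1,
      ‖derivWithin f (Set.Ioc (0 : ℝ) 1) x‖ ≤ M * x ^ (β - 1) := fun x hx ↦ by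
    simpa [iteratedDerivWithin_one] using
      norm_iteratedDerivWithin_le_snormNeg_mul_rpow hbdd le_rfl hx
  have hk' : 0 < 1 / k := one_div_pos.2 hk
  have hβ1' : 0 < 1 + β := by linarith
  have hnβ : 0 < -β := by linarith
  rw [abs_of_neg hβ0, sub_neg_eq_add]
  rcases le_total ε (1 / k) with hεk | hkε
  · calc _ ≤ M * (ε ^ (1 + β) / (1 + β)) := norm_integral_mul_exp_le_of_norm_le_rpow hβ1 hε.1.le
          (fun x hx ↦ hfle x ⟨hx.1, hx.2.trans hε.2⟩) k
      _ ≤ M * ((1 / k) ^ (1 + β) / (1 + β)) := by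
          have := hε.1.le
          gcongr
      _ = 1 / (1 + β) * 1 * (1 / k) ^ (1 + β) * M := by ring
      _ ≤ 1 / (1 + β) * ((2 + -β) / (-β)) * (1 / k) ^ (1 + β) * M := by
          gcongr
          rw [le_div_iff₀ hnβ]
          linarith
  · have hsub : Set.Icc (1 / k) ε ⊆ Set.Ioc (0 : ℝ) 1 :=
      fun x hx ↦ ⟨hk'.trans_le hx.1, hx.2.trans hε.2⟩
    have hhead := norm_integral_mul_exp_le_of_norm_le_rpow hβ1 hk'.le
      (fun x hx ↦ hfle x ⟨hx.1, hx.2.trans (hkε.trans hε.2)⟩) k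
    have htail := norm_integral_mul_exp_le_of_hasDerivAt ⟨hβ1, hβ0⟩ hM hk' hkε hk
      (hdiff.continuousOn.mono hsub)
      ((hdiff.continuousOn_derivWithin (uniqueDiffOn_Ioc 0 1) le_rfl).mono hsub)
      (fun x hx ↦ ((hdiff.differentiableOn one_ne_zero) x
        (hsub (Set.Ioo_subset_Icc_self hx))).hasDerivWithinAt.hasDerivAt
          (Ioc_mem_nhds (hk'.trans hx.1) (hx.2.trans_le hε.2)))
      (fun x hx ↦ hfle x (hsub hx)) (fun x hx ↦ hf'le x (hsub hx))
    have hintegrable : IntervalIntegrable (fun x : ℝ ↦ f x * Complex.exp (Complex.I * k * x))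
        MeasureTheory.volume 0 ε := by
      refine IntervalIntegrable.mul_continuousOn ?_ (Continuous.continuousOn (by fun_prop))
      refine ((intervalIntegral.intervalIntegrable_rpow' hβ1).const_mul M).mono_fun' ?_ ?_
      · rw [Set.uIoc_of_le hε.1.le]
        exact (hdiff.continuousOn.mono (Set.Ioc_subset_Ioc_right hε.2)).aestronglyMeasurable
          measurableSet_Ioc
      · rw [Set.uIoc_of_le hε.1.le]
        filter_upwards [MeasureTheory.ae_restrict_mem measurableSet_Ioc] with x hx
        exact hfle x ⟨hx.1, hx.2.trans hε.2⟩
    rw [← intervalIntegral.integral_add_adjacent_intervals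
      (hintegrable.mono_set (Set.uIcc_subset_uIcc_left (Set.mem_uIcc_of_le hk'.le hkε)))
      (hintegrable.mono_set (Set.uIcc_subset_uIcc_right (Set.mem_uIcc_of_le hk'.le hkε)))]
    calc _ ≤ M * ((1 / k) ^ (1 + β) / (1 + β)) + M / k * ((1 / k) ^ β * (1 + 1 / (-β))) :=
          (norm_add_le _ _).trans (add_le_add hhead htail)
      _ = (1 / (1 + β) * ((1 - β - β ^ 2) / (-β))) * (1 / k) ^ (1 + β) * M := by
          have hβne := hβ0.ne
          have hβne' := hβ1'.ne'
          rw [Real.rpow_add hk', Real.rpow_one, div_neg, div_neg]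
          field_simp
          ring
      _ ≤ 1 / (1 + β) * ((2 + -β) / (-β)) * (1 / k) ^ (1 + β) * M := by
          gcongr
          nlinarith
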